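/- Let γ > 1, p > 0 be real numbers and let s ∈ ℝ. Then ∫_0^∞ t^{γ-2} ((s+t)_-)^p dt = B(γ-1, p+1) · (s_-)^{γ+p-1}, where B denotes the Euler Beta function. In particular, for p = 1 the constant is B(γ-1, 2) = 1/(γ(γ-1)). -/

import Mathlib

open MeasureTheory

/-- The negative part of a real number: `t₋ = max(0, -t)`. -/
noncomputable def negPt (t : ℝ) : ℝ := max 0 (-t)

/-- The Euler Beta function `B(x, y) = Γ(x)Γ(y)/Γ(x+y)`. -/
noncomputable def realBeta (x y : ℝ) : ℝ := Real.Gamma x * Real.Gamma y / Real.Gamma (x + y)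

theorem negPt_of_nonneg {t : ℝ} (ht : 0 ≤ t) : negPt t = 0 :=
  max_eq_left (neg_nonpos.mpr ht)

theorem negPt_of_nonpos {t : ℝ} (ht : t ≤ 0) : negPt t = -t :=
  max_eq_right (neg_nonneg.mpr ht)

theorem integral_rpow_mul_sub_rpow {x y a : ℝ} (hx : 0 < x) (hy : 0 < y) (ha : 0 < a) :
    (∫ t in (0 : ℝ)..a, t ^ (x - 1) * (a - t) ^ (y - 1)) =
      realBeta x y * a ^ (x + y - 1) := by
  have h := Complex.betaIntegral_scaled (x : ℂ) (y : ℂ) ha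
  rw [Complex.betaIntegral_eq_Gamma_mul_div _ _ (by simpa using hx) (by simpa using hy)] at h
  rw [← Complex.ofReal_inj, ← intervalIntegral.integral_ofReal]
  have hint : (∫ t in (0 : ℝ)..a, ((t ^ (x - 1) * (a - t) ^ (y - 1) : ℝ) : ℂ)) =
      ∫ t in (0 : ℝ)..a, (t : ℂ) ^ ((x : ℂ) - 1) * ((a : ℂ) - t) ^ ((y : ℂ) - 1) := by
    refine intervalIntegral.integral_congr fun t ht => ?_
    rw [Set.uIcc_of_le ha.le] at ht
    rw [Complex.ofReal_mul, Complex.ofReal_cpow ht.1, Complex.ofReal_cpow (sub_nonneg.mpr ht.2)]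
    push_cast
    rfl
  rw [hint, h, realBeta, Complex.ofReal_mul, Complex.ofReal_cpow ha.le]
  push_cast [← Complex.Gamma_ofReal]
  ring

theorem realBeta_two_right {x : ℝ} (hx : 0 < x) : realBeta x 2 = 1 / ((x + 1) * x) := by
  have h : Real.Gamma (x + 2) = (x + 1) * (x * Real.Gamma x) := by
    rw [← Real.Gamma_add_one hx.ne', ← Real.Gamma_add_one (by positivity)]
    ring_nf
  have := Real.Gamma_pos_of_pos hx
  rw [realBeta, h, Real.Gamma_two]
  field_simp

theorem stmt0 (γ p : ℝ) (hγ : 1 < γ) (hp : 0 < p) (s : ℝ) :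
    (∫ t in Set.Ioi (0:ℝ), t ^ (γ - 2) * negPt (s + t) ^ p) =
      realBeta (γ - 1) (p + 1) * negPt s ^ (γ + p - 1) ∧
    realBeta (γ - 1) 2 = 1 / (γ * (γ - 1)) := by
  refine ⟨?_, by rw [realBeta_two_right (sub_pos.mpr hγ), sub_add_cancel]⟩
  rcases le_or_gt 0 s with hs | hs
  · rw [negPt_of_nonneg hs, Real.zero_rpow (by linarith), mul_zero]
    refine setIntegral_eq_zero_of_forall_eq_zero fun t ht => ?_
    rw [negPt_of_nonneg (add_nonneg hs (Set.mem_Ioi.mp ht).le), Real.zero_rpow hp.ne', mul_zero]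
  · have hbeta := integral_rpow_mul_sub_rpow (sub_pos.mpr hγ) (by linarith : 0 < p + 1)
      (neg_pos.mpr hs)
    rw [intervalIntegral.integral_of_le (neg_pos.mpr hs).le] at hbeta
    rw [negPt_of_nonpos hs.le, show γ + p - 1 = γ - 1 + (p + 1) - 1 by ring, ← hbeta,
      setIntegral_eq_of_subset_of_forall_sdiff_eq_zero measurableSet_Ioi
        (Set.Ioc_subset_Ioi_self : Set.Ioc 0 (-s) ⊆ Set.Ioi 0)]
    · refine setIntegral_congr_fun measurableSet_Ioc fun t ht => ?_
      rw [negPt_of_nonpos (by linarith [ht.2]), show -(s + t) = -s - t by ring,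
        add_sub_cancel_right, show γ - 1 - 1 = γ - 2 by ring]
    · rintro t ⟨ht, hts⟩
      have hst : -s < t := by
        by_contra! h
        exact hts ⟨ht, h⟩
      rw [negPt_of_nonneg (by linarith), Real.zero_rpow hp.ne', mul_zero]
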